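/- arXiv:1407.1786 — 2 statements merged into one kernel-verified Lean document; each statement's English description precedes it below -/
import Mathlib

section
/- Let P be an N×N complex Hermitian positive semidefinite matrix with eigenvalues μ₁ ≥ μ₂ ≥ … ≥ μ_N ≥ 0 and corresponding orthonormal eigenvectors u₁, …, u_N, let M_p ≤ N be a positive integer, and let ρ > 0. Then there exist nonnegative reals d₁, …, d_{M_p} with d₁ + … + d_{M_p} ≤ ρ·M_p such that the matrix S* whose i-th column is √(d_i)·u_i satisfies MSE(S*) ≤ MSE(S) for every N×M_p complex matrix S with ‖S‖_F² ≤ ρ·M_p. That is, the MSE-minimizing training matrix under the Frobenius-norm power constraint is a properly scaled version of the M_p dominant eigenvectors of P. -/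
open Matrix BigOperators
open scoped ComplexOrder

/-- Post-measurement mean square error (real part of the trace, which is real for
Hermitian PSD `P`): `MSE(S) = tr(P − P·S·(Sᴴ·P·S + I)⁻¹·Sᴴ·P)`. -/
noncomputable def kalmanMSE {N Mp : ℕ} (P : Matrix (Fin N) (Fin N) ℂ)
    (S : Matrix (Fin N) (Fin Mp) ℂ) : ℝ :=
  ((P - P * S * (Sᴴ * P * S + 1)⁻¹ * Sᴴ * P).trace).re

theorem sum_mul_le_sum_castLE_of_antitone {N M : ℕ} (hM : 0 < M) (hMN : M ≤ N) {w q : Fin N → ℝ}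
    (hw : Antitone w) (hw0 : ∀ i, 0 ≤ w i) (hq0 : ∀ i, 0 ≤ q i) (hq1 : ∀ i, q i ≤ 1)
    (hq : ∑ i, q i ≤ M) : ∑ i, w i * q i ≤ ∑ j : Fin M, w (Fin.castLE hMN j) := by
  set m : Fin N := ⟨M - 1, by omega⟩ with hm
  have hpt : ∀ i, (w i - w m) * q i ≤ if (i : ℕ) < M then w i - w m else 0 := by
    intro i
    split_ifs with h
    · have : w m ≤ w i := hw (by rw [Fin.le_def]; simp [hm]; omega)
      nlinarith [hq1 i]
    · have : w i ≤ w m := hw (by rw [Fin.le_def]; simp [hm]; omega)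
      nlinarith [hq0 i]
  have hsum : (∑ i : Fin N, if (i : ℕ) < M then w i - w m else 0)
      = ∑ j : Fin M, (w (Fin.castLE hMN j) - w m) := by
    rw [← Finset.sum_filter]
    symm
    refine Finset.sum_bij (fun j _ => Fin.castLE hMN j) (by simp) (by simp) ?_ (by simp)
    intro i hi
    exact ⟨⟨i, by simpa using hi⟩, by simp, rfl⟩
  have h1 := Finset.sum_le_sum fun i (_ : i ∈ Finset.univ) => hpt i
  rw [hsum] at h1
  simp only [sub_mul, Finset.sum_sub_distrib, ← Finset.mul_sum, Finset.sum_const,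
    Finset.card_univ, Fintype.card_fin, nsmul_eq_mul] at h1
  nlinarith [mul_le_mul_of_nonneg_left hq (hw0 m)]

theorem exists_waterLevel {ι : Type*} [Fintype ι] {μ : ι → ℝ} (hμ : ∀ i, 0 ≤ μ i) {k : ι}
    (hk : 0 < μ k) {c : ℝ} (hc : 0 < c) :
    ∃ s : ℝ, 0 < s ∧ ∑ i, max 0 (s * μ i - 1) / μ i = c := by
  have hcont : Continuous fun s : ℝ => ∑ i, max 0 (s * μ i - 1) / μ i := by fun_prop
  have hnn : ∀ s i, 0 ≤ max 0 (s * μ i - 1) / μ i := fun s i =>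
    div_nonneg (le_max_left _ _) (hμ i)
  have hb : 0 ≤ c + 1 / μ k := by positivity
  have h0 : ∑ i, max 0 ((0 : ℝ) * μ i - 1) / μ i = 0 := by norm_num
  have h1 : c ≤ ∑ i, max 0 ((c + 1 / μ k) * μ i - 1) / μ i := by
    refine le_trans ?_ (Finset.single_le_sum (fun i _ => hnn _ i) (Finset.mem_univ k))
    rw [le_div_iff₀ hk]
    refine le_trans (le_of_eq ?_) (le_max_right _ _)
    field_simp
    ring
  obtain ⟨s, hs, hsc⟩ := intermediate_value_Icc hb hcont.continuousOn
    (show c ∈ Set.Icc _ _ from ⟨h0.le.trans hc.le, h1⟩)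
  refine ⟨s, lt_of_le_of_ne hs.1 ?_, hsc⟩
  rintro rfl
  exact hc.ne (h0.symm.trans hsc)

theorem waterFilling_gain_eq {m s : ℝ} (hm : 0 ≤ m) (hs : 0 < s) :
    m ^ 2 * (max 0 (s * m - 1) / m) / (1 + m * (max 0 (s * m - 1) / m))
      = (1 / s) ^ 2 * (max 0 (s * m - 1) / m) + (m - min m (1 / s)) ^ 2 / m := by
  rcases hm.eq_or_lt with rfl | hm
  · simp
  rcases le_total (s * m) 1 with h | h
  · have : m ≤ 1 / s := by rw [le_div_iff₀ hs]; linarith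
    rw [max_eq_left (by linarith), min_eq_left this]
    simp
  · have : 1 / s ≤ m := by rw [div_le_iff₀ hs]; linarith
    rw [max_eq_right (by linarith), min_eq_right this]
    have : 1 + m * ((s * m - 1) / m) = s * m := by field_simp; ring
    rw [this]
    field_simp
    ring

theorem sq_sub_min_div_mono {t a b : ℝ} (ht : 0 ≤ t) (ha : 0 ≤ a) (hab : a ≤ b) :
    (a - min a t) ^ 2 / a ≤ (b - min b t) ^ 2 / b := by
  rcases le_total a t with h | h
  · rw [min_eq_left h]
    simpa using div_nonneg (sq_nonneg _) (ha.trans hab)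
  rcases ha.eq_or_lt with rfl | ha
  · simpa using div_nonneg (sq_nonneg _) hab
  rw [min_eq_right h, min_eq_right (h.trans hab), div_le_div_iff₀ ha (ha.trans_le hab)]
  nlinarith [mul_nonneg (sub_nonneg.2 hab) (sub_nonneg.2 (show t * t ≤ a * b by
    exact mul_le_mul h (h.trans hab) ht ha.le))]

theorem exists_projection_mul_eq_self {N M : ℕ} (K : Matrix (Fin N) (Fin M) ℂ) :
    ∃ Q : Matrix (Fin N) (Fin N) ℂ, Qᴴ = Q ∧ Q * Q = Q ∧ Q * K = K ∧ Q.trace.re ≤ M := by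
  set W : Submodule ℂ (EuclideanSpace ℂ (Fin N)) :=
    LinearMap.range (Matrix.toEuclideanLin K) with hW
  let e := Matrix.toEuclideanCLM (n := Fin N) (𝕜 := ℂ)
  set Q := e.symm W.starProjection with hQ
  have heQ : e Q = W.starProjection := e.apply_symm_apply _
  have hinj : Function.Injective e := EquivLike.injective e
  have hmem : ∀ v, W.starProjection v ∈ W := fun v => Submodule.starProjection_apply_mem W v
  refine ⟨Q, ?_, ?_, ?_, ?_⟩
  · rw [← star_eq_conjTranspose]
    apply hinj
    rw [map_star, heQ]
    exact isStarProjection_starProjection.isSelfAdjoint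
  · apply hinj
    rw [map_mul, heQ]
    exact isStarProjection_starProjection.isIdempotentElem
  · refine Matrix.ext_of_mulVec_single fun j => ?_
    rw [← Matrix.mulVec_mulVec]
    have h : e Q (WithLp.toLp 2 (K *ᵥ Pi.single j 1)) = WithLp.toLp 2 (K *ᵥ Pi.single j 1) := by
      rw [heQ, Submodule.starProjection_eq_self_iff]
      exact ⟨WithLp.toLp 2 (Pi.single j 1), rfl⟩
    exact congrArg WithLp.ofLp h
  · have hproj : LinearMap.IsProj W (W.starProjection : EuclideanSpace ℂ (Fin N) →ₗ[ℂ] _) :=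
      ⟨hmem, fun v hv => Submodule.starProjection_eq_self_iff.2 hv⟩
    have htr : Q.trace = Module.finrank ℂ W := by
      rw [← hproj.trace, ← heQ]
      change _ = LinearMap.trace ℂ _
        (Matrix.toLin (PiLp.basisFun 2 ℂ (Fin N)) (PiLp.basisFun 2 ℂ (Fin N)) Q)
      rw [LinearMap.trace_eq_matrix_trace ℂ
        (PiLp.basisFun 2 ℂ (Fin N)), LinearMap.toMatrix_toLin]
    rw [htr, Complex.natCast_re, Nat.cast_le]
    refine (LinearMap.finrank_range_le _).trans ?_
    simp

theorem two_mul_re_le_of_nonneg {m a : ℝ} (hm : 0 ≤ m) (ha : m = 0 → a = 0) (z v : ℂ) :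
    2 * a * (z * v).re ≤ m * Complex.normSq z + a ^ 2 / m * Complex.normSq v := by
  rcases hm.eq_or_lt with rfl | hm
  · simp [ha rfl]
  simp only [Complex.normSq_apply, Complex.mul_re]
  have h : 0 ≤ ((m * z.re - a * v.re) ^ 2 + (m * z.im + a * v.im) ^ 2) / m := by positivity
  have e : ((m * z.re - a * v.re) ^ 2 + (m * z.im + a * v.im) ^ 2) / m
      = m * (z.re * z.re + z.im * z.im) + a ^ 2 / m * (v.re * v.re + v.im * v.im)
        - 2 * a * (z.re * v.re - z.im * v.im) := by
    field_simp
    ring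
  linarith

theorem re_diag_eq_sum_normSq {N : ℕ} {Q : Matrix (Fin N) (Fin N) ℂ} (hQ : Qᴴ = Q)
    (hQQ : Q * Q = Q) (i : Fin N) : (Q i i).re = ∑ k, Complex.normSq (Q k i) := by
  conv_lhs => rw [← hQQ, Matrix.mul_apply, Complex.re_sum]
  refine Finset.sum_congr rfl fun k _ => ?_
  have : Q i k = star (Q k i) := by rw [← conjTranspose_apply, hQ]
  rw [this]
  simp [Complex.normSq_apply]

theorem re_mul_conjTranspose_diag_le {N M : ℕ} {μ T : Fin N → ℝ} (hμ : ∀ i, 0 ≤ μ i)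
    (hT : ∀ i, μ i = 0 → T i = 0) {S K : Matrix (Fin N) (Fin M) ℂ}
    {Q : Matrix (Fin N) (Fin N) ℂ} (hQ : Qᴴ = Q) (hQQ : Q * Q = Q) (hQK : Q * K = K)
    (i : Fin N) :
    2 * μ i * ((S * Kᴴ) i i).re ≤ μ i * ∑ k, Complex.normSq ((S * Kᴴ) i k)
      + ∑ j, Complex.normSq (K i j) + T i ^ 2 * ∑ j, Complex.normSq (S i j)
      + (μ i - T i) ^ 2 / μ i * (Q i i).re := by
  have hB : S * Kᴴ = S * Kᴴ * Q := by
    conv_lhs => rw [← hQK, conjTranspose_mul, hQ, ← Matrix.mul_assoc]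
  have h1 : 2 * (μ i - T i) * ((S * Kᴴ) i i).re ≤ μ i * ∑ k, Complex.normSq ((S * Kᴴ) i k)
      + (μ i - T i) ^ 2 / μ i * (Q i i).re := by
    rw [re_diag_eq_sum_normSq hQ hQQ]
    nth_rw 1 [hB]
    rw [Matrix.mul_apply, Complex.re_sum, Finset.mul_sum, Finset.mul_sum, Finset.mul_sum,
      ← Finset.sum_add_distrib]
    exact Finset.sum_le_sum fun k _ =>
      two_mul_re_le_of_nonneg (hμ i) (fun h => by rw [h, hT i h, sub_zero]) _ _
  have h2 : 2 * T i * ((S * Kᴴ) i i).re ≤ ∑ j, Complex.normSq (K i j)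
      + T i ^ 2 * ∑ j, Complex.normSq (S i j) := by
    rw [Matrix.mul_apply, Complex.re_sum, Finset.mul_sum, Finset.mul_sum,
      ← Finset.sum_add_distrib]
    refine Finset.sum_le_sum fun j _ => ?_
    have := two_mul_re_le_of_nonneg (m := 1) (a := T i) zero_le_one (by simp) (star (K i j)) (S i j)
    simp only [conjTranspose_apply, mul_comm (S i j)]
    simpa using this
  linarith

theorem kalmanMSE_conj {N Mp : ℕ} {P U : Matrix (Fin N) (Fin N) ℂ} (hU : Uᴴ * U = 1)
    (S : Matrix (Fin N) (Fin Mp) ℂ) :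
    kalmanMSE (U * P * Uᴴ) S = kalmanMSE P (Uᴴ * S) := by
  unfold kalmanMSE
  have h : U * P * Uᴴ - U * P * Uᴴ * S * (Sᴴ * (U * P * Uᴴ) * S + 1)⁻¹ * Sᴴ * (U * P * Uᴴ)
      = U * ((P - P * (Uᴴ * S) * ((Uᴴ * S)ᴴ * P * (Uᴴ * S) + 1)⁻¹ * (Uᴴ * S)ᴴ * P) * Uᴴ) := by
    simp only [conjTranspose_mul, conjTranspose_conjTranspose, Matrix.mul_sub, Matrix.sub_mul,
      Matrix.mul_assoc]
  rw [h, Matrix.trace_mul_comm, Matrix.mul_assoc, hU, Matrix.mul_one]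

theorem isUnit_conjTranspose_mul_mul_add_one {N M : ℕ} {P : Matrix (Fin N) (Fin N) ℂ}
    (hP : P.PosSemidef) (S : Matrix (Fin N) (Fin M) ℂ) : IsUnit (Sᴴ * P * S + 1).det := by
  rw [← Matrix.isUnit_iff_isUnit_det]
  exact ((Matrix.PosDef.one).posSemidef_add (hP.conjTranspose_mul_mul_same S)).isUnit

theorem sum_sub_kalmanMSE_diagonal_le {N M : ℕ} (hM : 0 < M) (hMN : M ≤ N) {μ : Fin N → ℝ}
    (hμ : ∀ i, 0 ≤ μ i) (hanti : Antitone μ) {t : ℝ} (ht : 0 ≤ t)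
    (S : Matrix (Fin N) (Fin M) ℂ) :
    ∑ i, μ i - kalmanMSE (diagonal fun i => (μ i : ℂ)) S ≤
      t ^ 2 * ∑ i, ∑ j, Complex.normSq (S i j)
        + ∑ j : Fin M, (μ (Fin.castLE hMN j) - min (μ (Fin.castLE hMN j)) t) ^ 2
          / μ (Fin.castLE hMN j) := by
  set D : Matrix (Fin N) (Fin N) ℂ := diagonal fun i => (μ i : ℂ) with hD
  have hDpsd : D.PosSemidef := PosSemidef.diagonal fun i => by simpa using hμ i
  have hDh : Dᴴ = D := hDpsd.isHermitian
  set A := Sᴴ * D * S + 1 with hA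
  have hAu : IsUnit A.det := isUnit_conjTranspose_mul_mul_add_one hDpsd S
  have hAh : Aᴴ = A := by
    simp [hA, conjTranspose_mul, hDh, Matrix.mul_assoc]
  set K := D * S * A⁻¹ with hK
  have hKh : Kᴴ = A⁻¹ * Sᴴ * D := by
    simp [hK, conjTranspose_mul, conjTranspose_nonsing_inv, hAh, hDh, Matrix.mul_assoc]
  have hKA : K * A = D * S := by rw [hK, Matrix.mul_assoc, nonsing_inv_mul _ hAu, Matrix.mul_one]
  set B := S * Kᴴ with hBdef
  have hgain : D * S * A⁻¹ * Sᴴ * D = D * B := by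
    rw [hBdef, hKh]; simp only [Matrix.mul_assoc]
  have hquad : D * B = Bᴴ * D * B + K * Kᴴ := by
    have : D * B = K * A * Kᴴ := by rw [hKA, hBdef, Matrix.mul_assoc]
    rw [this, hA, hBdef]
    simp only [Matrix.mul_add, Matrix.add_mul, conjTranspose_mul, conjTranspose_conjTranspose,
      Matrix.mul_assoc, Matrix.one_mul]
  have htrDB : (D * B).trace.re = ∑ i, μ i * (B i i).re := by
    simp [Matrix.trace, hD, diagonal_mul]
  have htrBDB : (Bᴴ * D * B).trace.re = ∑ i, μ i * ∑ k, Complex.normSq (B i k) := by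
    rw [Matrix.mul_assoc, Matrix.trace_mul_comm, Matrix.mul_assoc]
    simp only [Matrix.trace, diag_apply, hD, diagonal_mul]
    simp only [Matrix.mul_apply, Complex.re_sum, Finset.mul_sum, conjTranspose_apply]
    refine Finset.sum_congr rfl fun i _ => Finset.sum_congr rfl fun k _ => ?_
    simp [Complex.normSq_apply]
  have htrKK : (K * Kᴴ).trace.re = ∑ i, ∑ j, Complex.normSq (K i j) := by
    simp only [Matrix.trace, diag_apply, Matrix.mul_apply, Complex.re_sum, conjTranspose_apply]
    refine Finset.sum_congr rfl fun i _ => Finset.sum_congr rfl fun k _ => ?_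
    simp [Complex.normSq_apply]
  have hmse : ∑ i, μ i - kalmanMSE D S = (D * B).trace.re := by
    have : kalmanMSE D S = ((D - D * B).trace).re := by
      rw [← hgain]; rfl
    rw [this, trace_sub, Complex.sub_re]
    simp [hD]
  have hq := congrArg (fun X => X.trace.re) hquad
  simp only [trace_add, Complex.add_re, htrDB, htrBDB, htrKK] at hq
  obtain ⟨Q, hQ, hQQ, hQK, hQtr⟩ := exists_projection_mul_eq_self K
  set T : Fin N → ℝ := fun i => min (μ i) t with hT
  have hT0 : ∀ i, μ i = 0 → T i = 0 := fun i h => by simp [hT, h, ht]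
  have hmain := Finset.sum_le_sum fun i (_ : i ∈ Finset.univ) =>
    re_mul_conjTranspose_diag_le hμ hT0 (S := S) hQ hQQ hQK i
  simp only [Finset.sum_add_distrib, mul_assoc, ← Finset.mul_sum, ← hBdef] at hmain
  have hTS : ∑ i, T i ^ 2 * ∑ j, Complex.normSq (S i j)
      ≤ t ^ 2 * ∑ i, ∑ j, Complex.normSq (S i j) := by
    rw [Finset.mul_sum]
    refine Finset.sum_le_sum fun i _ => mul_le_mul_of_nonneg_right ?_
      (Finset.sum_nonneg fun j _ => Complex.normSq_nonneg _)
    exact pow_le_pow_left₀ (le_min (hμ i) ht) (min_le_right _ _) 2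
  have hQii := re_diag_eq_sum_normSq hQ hQQ
  have hq0 : ∀ i, 0 ≤ (Q i i).re := fun i => by
    rw [hQii]; exact Finset.sum_nonneg fun k _ => Complex.normSq_nonneg _
  have hq1 : ∀ i, (Q i i).re ≤ 1 := fun i => by
    have h := Finset.single_le_sum (fun k _ => Complex.normSq_nonneg (Q k i)) (Finset.mem_univ i)
    rw [← hQii, Complex.normSq_apply] at h
    nlinarith [mul_self_nonneg (Q i i).im]
  have hky := sum_mul_le_sum_castLE_of_antitone hM hMN
    (w := fun i => (μ i - T i) ^ 2 / μ i) (q := fun i => (Q i i).re)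
    (fun i j hij => sq_sub_min_div_mono ht (hμ j) (hanti hij))
    (fun i => div_nonneg (sq_nonneg _) (hμ i)) hq0 hq1
    (by simpa [Matrix.trace] using hQtr)
  rw [hmse, htrDB]
  linarith

theorem kalmanMSE_diagonal_eq {N M : ℕ} (hMN : M ≤ N) {μ : Fin N → ℝ} (hμ : ∀ i, 0 ≤ μ i)
    {d : Fin M → ℝ} (hd : ∀ j, 0 ≤ d j) :
    kalmanMSE (diagonal fun i => (μ i : ℂ))
      (Matrix.of fun i j => if i = Fin.castLE hMN j then (Real.sqrt (d j) : ℂ) else 0)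
      = ∑ i, μ i - ∑ j, μ (Fin.castLE hMN j) ^ 2 * d j / (1 + μ (Fin.castLE hMN j) * d j) := by
  set D : Matrix (Fin N) (Fin N) ℂ := diagonal fun i => (μ i : ℂ) with hD
  set S : Matrix (Fin N) (Fin M) ℂ :=
    Matrix.of fun i j => if i = Fin.castLE hMN j then (Real.sqrt (d j) : ℂ) else 0 with hS
  have hsq : ∀ j, (Real.sqrt (d j) : ℂ) * (Real.sqrt (d j) : ℂ) = (d j : ℂ) := fun j => by
    rw [← Complex.ofReal_mul, Real.mul_self_sqrt (hd j)]
  have hform : ∀ ν : Fin N → ℂ, Sᴴ * diagonal ν * S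
      = diagonal fun j => ν (Fin.castLE hMN j) * (d j : ℂ) := by
    intro ν
    ext j k
    rw [Matrix.mul_apply, Finset.sum_eq_single (Fin.castLE hMN j)]
    · rcases eq_or_ne j k with rfl | h
      · simp only [mul_diagonal, conjTranspose_apply, hS, of_apply, if_true, diagonal_apply_eq,
          RCLike.star_def, Complex.conj_ofReal]
        rw [← hsq j]
        ring
      · simp [hS, h]
    · intro i _ hi
      simp [hS, hi]
    · simp
  have hinv : (Sᴴ * D * S + 1)⁻¹
      = diagonal fun j => (((1 + μ (Fin.castLE hMN j) * d j)⁻¹ : ℝ) : ℂ) := by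
    apply inv_eq_left_inv
    rw [hD, hform, ← diagonal_one, diagonal_add, diagonal_mul_diagonal]
    congr 1
    ext j
    have : (1 + μ (Fin.castLE hMN j) * d j) ≠ 0 := by
      have := mul_nonneg (hμ (Fin.castLE hMN j)) (hd j)
      positivity
    rw [← Complex.ofReal_mul, ← Complex.ofReal_one, ← Complex.ofReal_add, ← Complex.ofReal_mul,
      add_comm (μ _ * d j), inv_mul_cancel₀ this]
  unfold kalmanMSE
  rw [hinv, trace_sub, Complex.sub_re]
  congr 1
  · simp [hD]
  · have hcycle : ∀ G : Matrix (Fin M) (Fin M) ℂ,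
        (D * S * G * Sᴴ * D).trace = (Sᴴ * (D * D) * S * G).trace := fun G => by
      rw [Matrix.mul_assoc, Matrix.trace_mul_comm]
      have h : Sᴴ * D * (D * S * G) = Sᴴ * (D * D) * S * G := by simp only [Matrix.mul_assoc]
      rw [h]
    rw [hcycle, hD, diagonal_mul_diagonal]
    rw [hform, diagonal_mul_diagonal, trace_diagonal, Complex.re_sum]
    refine Finset.sum_congr rfl fun j _ => ?_
    simp only [← Complex.ofReal_mul, Complex.ofReal_re]
    ring

theorem sum_normSq_eq_trace {N M : ℕ} (S : Matrix (Fin N) (Fin M) ℂ) :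
    ∑ i, ∑ j, Complex.normSq (S i j) = (Sᴴ * S).trace.re := by
  rw [Matrix.trace_mul_comm]
  simp only [Matrix.trace, diag_apply, Matrix.mul_apply, Complex.re_sum, conjTranspose_apply]
  refine Finset.sum_congr rfl fun i _ => Finset.sum_congr rfl fun k _ => ?_
  simp [Complex.normSq_apply]

theorem optimal_training_is_scaled_dominant_eigenvectors
    {N Mp : ℕ} (hMp : 0 < Mp) (hMN : Mp ≤ N)
    (P : Matrix (Fin N) (Fin N) ℂ) (hP : P.PosSemidef)
    (μ : Fin N → ℝ) (u : Fin N → (Fin N → ℂ))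
    (hμsort : ∀ i j : Fin N, i ≤ j → μ j ≤ μ i)
    (hμnn : ∀ i, 0 ≤ μ i)
    (horth : ∀ i j : Fin N, star (u i) ⬝ᵥ u j = if i = j then 1 else 0)
    (heig : ∀ i, P.mulVec (u i) = (μ i : ℂ) • u i)
    (ρ : ℝ) (hρ : 0 < ρ) :
    ∃ d : Fin Mp → ℝ, (∀ i, 0 ≤ d i) ∧ (∑ i, d i) ≤ ρ * Mp ∧
      ∀ S : Matrix (Fin N) (Fin Mp) ℂ,
        (∑ i, ∑ j, Complex.normSq (S i j)) ≤ ρ * Mp →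
        kalmanMSE P (Matrix.of fun i j => (Real.sqrt (d j) : ℂ) * u (Fin.castLE hMN j) i)
          ≤ kalmanMSE P S := by
  set U : Matrix (Fin N) (Fin N) ℂ := Matrix.of fun i j => u j i with hUdef
  set D : Matrix (Fin N) (Fin N) ℂ := diagonal fun i => (μ i : ℂ) with hD
  have hU : Uᴴ * U = 1 := by
    ext i j
    rw [Matrix.one_apply, ← horth i j]
    rfl
  have hU' : U * Uᴴ = 1 := mul_eq_one_comm.1 hU
  have hPU : P * U = U * D := by
    ext i j
    have h := congrFun (heig j) i
    rw [hD, mul_diagonal, Matrix.mul_apply]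
    simpa [Matrix.mulVec, dotProduct, hUdef, mul_comm] using h
  have hPD : P = U * D * Uᴴ := by
    rw [← hPU, Matrix.mul_assoc, hU', Matrix.mul_one]
  have hnorm : ∀ S : Matrix (Fin N) (Fin Mp) ℂ,
      ∑ i, ∑ j, Complex.normSq ((Uᴴ * S) i j) = ∑ i, ∑ j, Complex.normSq (S i j) := by
    intro S
    rw [sum_normSq_eq_trace, sum_normSq_eq_trace, conjTranspose_mul, conjTranspose_conjTranspose,
      Matrix.mul_assoc, ← Matrix.mul_assoc U, hU', Matrix.one_mul]
  have hopt : ∀ d : Fin Mp → ℝ,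
      Uᴴ * (Matrix.of fun i j => (Real.sqrt (d j) : ℂ) * u (Fin.castLE hMN j) i)
      = Matrix.of fun i j => if i = Fin.castLE hMN j then (Real.sqrt (d j) : ℂ) else 0 := by
    intro d
    ext i j
    have h := congrArg (fun z => (Real.sqrt (d j) : ℂ) * z) (horth i (Fin.castLE hMN j))
    simp only [mul_ite, mul_one, mul_zero] at h
    rw [of_apply, ← h, Matrix.mul_apply, dotProduct, Finset.mul_sum]
    refine Finset.sum_congr rfl fun k _ => ?_
    simp only [hUdef, conjTranspose_apply, of_apply, Pi.star_apply]
    ring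
  set k : Fin Mp := ⟨0, hMp⟩ with hk
  rcases (hμnn (Fin.castLE hMN k)).eq_or_lt with h0 | hpos
  · have hμ0 : ∀ i, μ i = 0 := fun i =>
      le_antisymm (h0 ▸ hμsort _ i (by rw [Fin.le_def]; simp [hk])) (hμnn i)
    have hP0 : P = 0 := by
      rw [hPD, hD]
      simp [hμ0]
    refine ⟨0, by simp, by simpa using by positivity, fun S _ => ?_⟩
    simp [hP0, kalmanMSE]
  have hc : 0 < ρ * Mp := mul_pos hρ (Nat.cast_pos.2 hMp)
  obtain ⟨s, hs, hsum⟩ := exists_waterLevel (μ := fun j : Fin Mp => μ (Fin.castLE hMN j))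
    (fun j => hμnn _) hpos hc
  have hd : ∀ j : Fin Mp, 0 ≤ max 0 (s * μ (Fin.castLE hMN j) - 1) / μ (Fin.castLE hMN j) :=
    fun j => div_nonneg (le_max_left _ _) (hμnn _)
  refine ⟨_, hd, hsum.le, fun S hS => ?_⟩
  rw [hPD, kalmanMSE_conj hU, kalmanMSE_conj hU, hopt, kalmanMSE_diagonal_eq hMN hμnn hd]
  have hbound := sum_sub_kalmanMSE_diagonal_le hMp hMN hμnn hμsort (one_div_pos.2 hs).le (Uᴴ * S)
  rw [hnorm] at hbound
  simp only [waterFilling_gain_eq (hμnn _) hs, Finset.sum_add_distrib, ← Finset.mul_sum, hsum]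
  have := mul_le_mul_of_nonneg_left hS (sq_nonneg (1 / s))
  linarith
end

section
/- Let a ∈ (0,1), λ > 0, ρ > 0, and let g ≥ 1 be an integer. For any x₀ ≥ 0, the sequence defined by x_{n+1} = f_g(x_n) converges to λ*(g) as n → ∞; i.e., the periodically re-sounded Kalman eigenvalue recursion λ̄^{(ℓ)} = f_g(λ̄^{(ℓ−g)}) converges to the minimum steady-state MSE λ*(g). -/
/-- Minimum steady-state MSE along a sounded eigen-direction. -/
noncomputable def lamStar (a lam ρ : ℝ) (g : ℕ) : ℝ :=
  lam / ((1/2)*(1+lam*ρ) + Real.sqrt (((1/2)*(1+lam*ρ))^2 + (a^(2*g)/(1-a^(2*g)))*(lam*ρ)))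

/-- The g-block Riccati map. -/
noncomputable def riccatiMap (a lam ρ : ℝ) (g : ℕ) (x : ℝ) : ℝ :=
  (a^(2*g)*x + (1-a^(2*g))*lam) / (ρ*(a^(2*g)*x + (1-a^(2*g))*lam) + 1)

theorem riccatiMap_nonneg {a lam ρ x : ℝ} {g : ℕ} (hq0 : 0 ≤ a ^ (2 * g))
    (hq1 : a ^ (2 * g) ≤ 1) (hlam : 0 ≤ lam) (hρ : 0 ≤ ρ) (hx : 0 ≤ x) :
    0 ≤ riccatiMap a lam ρ g x := by
  have := sub_nonneg.2 hq1
  unfold riccatiMap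
  positivity

theorem abs_riccatiMap_sub_le {a lam ρ x y : ℝ} {g : ℕ} (hq0 : 0 ≤ a ^ (2 * g))
    (hq1 : a ^ (2 * g) ≤ 1) (hlam : 0 ≤ lam) (hρ : 0 ≤ ρ) (hx : 0 ≤ x) (hy : 0 ≤ y) :
    |riccatiMap a lam ρ g x - riccatiMap a lam ρ g y| ≤ a ^ (2 * g) * |x - y| := by
  unfold riccatiMap
  generalize a ^ (2 * g) = q at *
  have := sub_nonneg.2 hq1
  have hu : 0 ≤ ρ * (q * x + (1 - q) * lam) := by positivity
  have hv : 0 ≤ ρ * (q * y + (1 - q) * lam) := by positivity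
  have hu' : ρ * (q * x + (1 - q) * lam) + 1 ≠ 0 := by positivity
  have hv' : ρ * (q * y + (1 - q) * lam) + 1 ≠ 0 := by positivity
  have key : (q * x + (1 - q) * lam) / (ρ * (q * x + (1 - q) * lam) + 1)
      - (q * y + (1 - q) * lam) / (ρ * (q * y + (1 - q) * lam) + 1)
      = q * (x - y) / ((ρ * (q * x + (1 - q) * lam) + 1) *
        (ρ * (q * y + (1 - q) * lam) + 1)) := by
    rw [div_sub_div _ _ hu' hv']
    congr 1
    ring
  rw [key, abs_div, abs_mul, abs_of_nonneg hq0]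
  refine div_le_self (by positivity) ?_
  rw [abs_of_nonneg (by positivity)]
  nlinarith [mul_nonneg hu hv]

theorem lamStar_nonneg {a lam ρ : ℝ} {g : ℕ} (hlam : 0 ≤ lam) (hρ : 0 ≤ ρ) :
    0 ≤ lamStar a lam ρ g := by
  unfold lamStar
  positivity

theorem riccatiMap_lamStar {a lam ρ : ℝ} {g : ℕ} (hq0 : 0 ≤ a ^ (2 * g))
    (hq1 : a ^ (2 * g) < 1) (hlam : 0 ≤ lam) (hρ : 0 ≤ ρ) :
    riccatiMap a lam ρ g (lamStar a lam ρ g) = lamStar a lam ρ g := by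
  unfold riccatiMap lamStar
  generalize a ^ (2 * g) = q at *
  have hq : 0 < 1 - q := sub_pos.2 hq1
  have hs := Real.sq_sqrt (show 0 ≤ ((1/2)*(1+lam*ρ))^2 + (q/(1-q))*(lam*ρ) by positivity)
  have hD : 0 < (1/2)*(1+lam*ρ) + Real.sqrt (((1/2)*(1+lam*ρ))^2 + (q/(1-q))*(lam*ρ)) := by
    positivity
  set D := (1/2)*(1+lam*ρ) + Real.sqrt (((1/2)*(1+lam*ρ))^2 + (q/(1-q))*(lam*ρ)) with hDdef
  have hroot : (1 - q) * (D ^ 2 - (1 + lam * ρ) * D) = q * (lam * ρ) := by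
    have h : D ^ 2 - (1 + lam * ρ) * D = q / (1 - q) * (lam * ρ) := by
      rw [hDdef]
      linear_combination hs
    rw [h]
    field_simp
  clear_value D
  have hden : ρ * (q * (lam / D) + (1 - q) * lam) + 1 ≠ 0 := by positivity
  rw [div_eq_iff hden]
  field_simp
  linear_combination lam * hroot

/-- The iterates of the g-block Riccati map converge to λ*(g) from any
nonnegative starting point. -/
theorem riccatiMap_iterates_tendsto_lamStar
    (a lam ρ : ℝ) (ha0 : 0 < a) (ha1 : a < 1) (hlam : 0 < lam) (hρ : 0 < ρ)
    (g : ℕ) (hg : 1 ≤ g) :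
    ∀ x₀ : ℝ, 0 ≤ x₀ →
      Filter.Tendsto (fun n => (riccatiMap a lam ρ g)^[n] x₀)
        Filter.atTop (nhds (lamStar a lam ρ g)) := by
  intro x₀ hx₀
  have hq0 : 0 ≤ a ^ (2 * g) := by positivity
  have hq1 : a ^ (2 * g) < 1 := pow_lt_one₀ ha0.le ha1 (by omega)
  have hnonneg (n : ℕ) : 0 ≤ (riccatiMap a lam ρ g)^[n] x₀ := by
    induction n with
    | zero => exact hx₀
    | succ n ih =>
      rw [Function.iterate_succ_apply']
      exact riccatiMap_nonneg hq0 hq1.le hlam.le hρ.le ih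
  have hbound (n : ℕ) : |(riccatiMap a lam ρ g)^[n] x₀ - lamStar a lam ρ g|
      ≤ (a ^ (2 * g)) ^ n * |x₀ - lamStar a lam ρ g| := by
    induction n with
    | zero => simp
    | succ n ih =>
      rw [Function.iterate_succ_apply', pow_succ', mul_assoc]
      nth_rw 1 [← riccatiMap_lamStar hq0 hq1 hlam.le hρ.le]
      exact (abs_riccatiMap_sub_le hq0 hq1.le hlam.le hρ.le (hnonneg n)
        (lamStar_nonneg hlam.le hρ.le)).trans (mul_le_mul_of_nonneg_left ih hq0)
  rw [tendsto_iff_dist_tendsto_zero]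
  refine squeeze_zero (fun _ => dist_nonneg) hbound ?_
  simpa using (tendsto_pow_atTop_nhds_zero_of_lt_one hq0 hq1).mul_const |x₀ - lamStar a lam ρ g|
end
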